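/- Let ℓ, m be nonnegative integers, let p be a real with 0 ≤ p ≤ 1, and let x be an integer. Then D(ℓ, m, p, x) = (1/(2π)) · ∫_{−π}^{π} Re( e^{ixy} · (1−p+p·e^{−iy})^ℓ · (1−p+p·e^{iy})^m ) dy, where i is the imaginary unit and Re denotes the real part. -/

import Mathlib

open Finset

/-- `D ℓ m p y` is the probability that `Bin(ℓ,p) - Bin(m,p) = y` for independent
binomials. -/
noncomputable def D (ℓ m : ℕ) (p : ℝ) (y : ℤ) : ℝ :=
  ∑ k ∈ Finset.range (ℓ + 1), ∑ j ∈ Finset.range (m + 1),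
    if (k : ℤ) - (j : ℤ) = y then
      (ℓ.choose k : ℝ) * (m.choose j : ℝ) * p ^ (k + j) * (1 - p) ^ ((ℓ - k) + (m - j))
    else 0

lemma integral_cos_int_mul (n : ℤ) :
    ∫ y in (-Real.pi)..Real.pi, Real.cos (n * y) = if n = 0 then 2 * Real.pi else 0 := by
  split_ifs with h
  · simp [h, two_mul]
  · have hn : (n : ℝ) ≠ 0 := by exact_mod_cast h
    rw [intervalIntegral.integral_comp_mul_left _ hn]
    simp [Real.sin_int_mul_pi]

lemma re_exp_mul_binomial_powers (ℓ m : ℕ) (p : ℝ) (x : ℤ) (y : ℝ) :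
    (Complex.exp (Complex.I * (x : ℂ) * (y : ℂ)) *
      (1 - (p : ℂ) + (p : ℂ) * Complex.exp (-Complex.I * (y : ℂ))) ^ ℓ *
      (1 - (p : ℂ) + (p : ℂ) * Complex.exp (Complex.I * (y : ℂ))) ^ m).re =
    ∑ k ∈ Finset.range (ℓ + 1), ∑ j ∈ Finset.range (m + 1),
      ((ℓ.choose k : ℝ) * (m.choose j : ℝ) * p ^ (k + j) * (1 - p) ^ ((ℓ - k) + (m - j))) *
        Real.cos ((x - k + j : ℤ) * y) := by
  rw [add_comm (1 - (p : ℂ)), add_comm (1 - (p : ℂ)), add_pow, add_pow, mul_assoc,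
    Finset.sum_mul_sum, Finset.mul_sum, Complex.re_sum]
  refine Finset.sum_congr rfl fun k _ ↦ ?_
  rw [Finset.mul_sum, Complex.re_sum]
  refine Finset.sum_congr rfl fun j _ ↦ ?_
  have hexp : Complex.exp (((x - k + j : ℤ) * y : ℝ) * Complex.I) =
      Complex.exp (Complex.I * x * y) * Complex.exp (-Complex.I * y) ^ k *
        Complex.exp (Complex.I * y) ^ j := by
    rw [← Complex.exp_nat_mul, ← Complex.exp_nat_mul, ← Complex.exp_add, ← Complex.exp_add]
    congr 1
    push_cast
    ring
  rw [← Complex.exp_ofReal_mul_I_re, ← Complex.re_ofReal_mul, hexp]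
  congr 1
  push_cast
  ring

/-- the Fourier-inversion formula
`D(ℓ, m, p, x) = (1/(2π)) ∫_{-π}^{π} Re(e^{ixy} (1-p+pe^{-iy})^ℓ (1-p+pe^{iy})^m) dy`. -/
theorem stmt_14 (ℓ m : ℕ) (p : ℝ) (hp0 : 0 ≤ p) (hp1 : p ≤ 1) (x : ℤ) :
    D ℓ m p x = (1 / (2 * Real.pi)) *
      ∫ y in (-Real.pi)..Real.pi,
        (Complex.exp (Complex.I * (x : ℂ) * (y : ℂ)) *
          (1 - (p : ℂ) + (p : ℂ) * Complex.exp (-Complex.I * (y : ℂ))) ^ ℓ *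
          (1 - (p : ℂ) + (p : ℂ) * Complex.exp (Complex.I * (y : ℂ))) ^ m).re := by
  simp only [re_exp_mul_binomial_powers]
  rw [intervalIntegral.integral_finsetSum
    fun k _ ↦ Continuous.intervalIntegrable (by fun_prop) _ _, Finset.mul_sum, D]
  refine Finset.sum_congr rfl fun k _ ↦ ?_
  rw [intervalIntegral.integral_finsetSum
    fun j _ ↦ Continuous.intervalIntegrable (by fun_prop) _ _, Finset.mul_sum]
  refine Finset.sum_congr rfl fun j _ ↦ ?_
  rw [intervalIntegral.integral_const_mul, integral_cos_int_mul]
  have hiff : (k : ℤ) - j = x ↔ x - k + j = 0 := by omega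
  simp only [hiff]
  split_ifs
  · field_simp
  · simp
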